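/- Let n ≥ 3 and let (S, 𝒜, ℛ) be a Schottky system. Then the subgroup of SL(n,ℤ) generated by S is the free product of the infinite cyclic groups ⟨u⟩, u ∈ S; equivalently, no nonempty reduced word u₁^{k₁}u₂^{k₂}⋯u_m^{k_m} (with u_i ∈ S, u_i ≠ u_{i+1}, and k_i nonzero integers) equals the identity, i.e., S freely generates a free group. -/

import Mathlib

/- Common setup: `SL(n,ℤ)`, `SL(n,ℝ)`, the real projective space `ℙ^{n-1}(ℝ)`
with its quotient topology and the projective action, rank-1 unipotent elements
and their attracting points / fixed hyperplanes, metrics compatible with the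
topology of `ℙ`, `ε`-neighbourhoods, Schottky systems, profinite density,
maximal subgroups, and lattices in `SL(n,ℝ)`. -/

open Matrix LinearAlgebra.Projectivization

abbrev SLZ (n : ℕ) := Matrix.SpecialLinearGroup (Fin n) ℤ

abbrev SLR (n : ℕ) := Matrix.SpecialLinearGroup (Fin n) ℝ

/-- The real projective space `ℙ^{n-1}(ℝ)`: the projectivization of `ℝⁿ`. -/
abbrev Proj (n : ℕ) := Projectivization ℝ (Fin n → ℝ)

/-- The quotient topology on `ℙ^{n-1}(ℝ)`. -/
noncomputable instance (n : ℕ) : TopologicalSpace (Proj n) :=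
  inferInstanceAs (TopologicalSpace (Quotient _))

/-- The action of `SL(n,ℝ)` on `ℙ^{n-1}(ℝ)` induced by the linear action on `ℝⁿ`. -/
noncomputable def actR {n : ℕ} (g : SLR n) (x : Proj n) : Proj n :=
  Projectivization.map (Matrix.SpecialLinearGroup.toLin' g).toLinearMap
    (Matrix.SpecialLinearGroup.toLin' g).injective x

/-- The action of `SL(n,ℤ)` on `ℙ^{n-1}(ℝ)` induced by the linear action on `ℝⁿ`. -/
noncomputable def act {n : ℕ} (g : SLZ n) (x : Proj n) : Proj n :=
  actR (Matrix.SpecialLinearGroup.map (Int.castRingHom ℝ) g) x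

/-- The real matrix attached to `g ∈ SL(n,ℤ)`. -/
noncomputable def matR {n : ℕ} (g : SLZ n) : Matrix (Fin n) (Fin n) ℝ :=
  ((Matrix.SpecialLinearGroup.map (Int.castRingHom ℝ)) g : Matrix (Fin n) (Fin n) ℝ)

/-- The subspace `Im(u - I) ⊆ ℝⁿ` (a line when `u` is rank-1 unipotent). -/
noncomputable def lineOf {n : ℕ} (u : SLZ n) : Submodule ℝ (Fin n → ℝ) :=
  LinearMap.range (Matrix.mulVecLin (matR u - 1))

/-- The subspace `ker(u - I) ⊆ ℝⁿ` (a hyperplane when `u` is rank-1 unipotent). -/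
noncomputable def hypOf {n : ℕ} (u : SLZ n) : Submodule ℝ (Fin n → ℝ) :=
  LinearMap.ker (Matrix.mulVecLin (matR u - 1))

/-- The rational matrix attached to `g ∈ SL(n,ℤ)`. -/
noncomputable def matQ {n : ℕ} (g : SLZ n) : Matrix (Fin n) (Fin n) ℚ :=
  ((Matrix.SpecialLinearGroup.map (Int.castRingHom ℚ)) g : Matrix (Fin n) (Fin n) ℚ)

/-- `g - I`, as a `ℚ`-linear endomorphism of `ℚⁿ`. -/
noncomputable def linQ {n : ℕ} (g : SLZ n) : (Fin n → ℚ) →ₗ[ℚ] (Fin n → ℚ) :=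
  Matrix.mulVecLin (matQ g - 1)

/-- `u` is a rank-1 unipotent element of `SL(n,ℤ)`: `u - I` is nilpotent of rank one. -/
def IsR1U {n : ℕ} (u : SLZ n) : Prop :=
  IsNilpotent (linQ u) ∧ Module.finrank ℚ (LinearMap.range (linQ u)) = 1

/-- The point of attraction `p_u` of `u`, as a subset of `ℙ` (a singleton when `u` is a
rank-1 unipotent): the projective points whose representative spans `Im(u - I)`. -/
def attSet {n : ℕ} (u : SLZ n) : Set (Proj n) :=
  {x | x.submodule = lineOf u}

/-- The fixed hyperplane `L_u` of `u`, as a subset of `ℙ`. -/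
def fixSet {n : ℕ} (u : SLZ n) : Set (Proj n) :=
  {x | x.submodule ≤ hypOf u}

/-- The subset of `ℙ` corresponding to a linear subspace `W ⊆ ℝⁿ`. -/
def projSet {n : ℕ} (W : Submodule ℝ (Fin n → ℝ)) : Set (Proj n) :=
  {x | x.submodule ≤ W}

/-- The image `g • W` of a subspace of `ℝⁿ` under `g ∈ SL(n,ℤ)`. -/
noncomputable def actSub {n : ℕ} (g : SLZ n) (W : Submodule ℝ (Fin n → ℝ)) :
    Submodule ℝ (Fin n → ℝ) :=
  Submodule.map (Matrix.mulVecLin (matR g)) W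

/-- The image `g • W` of a subspace of `ℝⁿ` under `g ∈ SL(n,ℝ)`. -/
noncomputable def actSubR {n : ℕ} (g : SLR n) (W : Submodule ℝ (Fin n → ℝ)) :
    Submodule ℝ (Fin n → ℝ) :=
  Submodule.map (Matrix.mulVecLin (g : Matrix (Fin n) (Fin n) ℝ)) W

/-- `d` is a metric on `ℙ^{n-1}(ℝ)` inducing the quotient topology. -/
structure IsCompatMetric {n : ℕ} (d : Proj n → Proj n → ℝ) : Prop where
  self : ∀ x, d x x = 0
  eq_of : ∀ x y, d x y = 0 → x = y
  symm : ∀ x y, d x y = d y x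
  triangle : ∀ x y z, d x z ≤ d x y + d y z
  inducing : ∀ s : Set (Proj n), IsOpen s ↔ ∀ x ∈ s, ∃ ε > 0, ∀ y, d x y < ε → y ∈ s

/-- The distance from a point to a set. -/
noncomputable def setDist {n : ℕ} (d : Proj n → Proj n → ℝ) (x : Proj n)
    (A : Set (Proj n)) : ℝ :=
  sInf (d x '' A)

/-- The open `ε`-neighbourhood `(A)_ε = {x | dist(x, A) < ε}`. -/
def oThick {n : ℕ} (d : Proj n → Proj n → ℝ) (A : Set (Proj n)) (ε : ℝ) : Set (Proj n) :=
  {x | setDist d x A < ε}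

/-- The closed `ε`-neighbourhood `[A]_ε = {x | dist(x, A) ≤ ε}`. -/
def cThick {n : ℕ} (d : Proj n → Proj n → ℝ) (A : Set (Proj n)) (ε : ℝ) : Set (Proj n) :=
  {x | setDist d x A ≤ ε}

/-- The Hausdorff distance between two subsets of `ℙ`. -/
noncomputable def hDist {n : ℕ} (d : Proj n → Proj n → ℝ) (A B : Set (Proj n)) : ℝ :=
  max (sSup ((fun a => setDist d a B) '' A)) (sSup ((fun b => setDist d b A) '' B))

/-- A rational point of `ℙ`: one spanned by a vector of `ℚⁿ`. -/
def RatPoint {n : ℕ} (p : Proj n) : Prop :=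
  ∃ v : Fin n → ℚ, p.submodule = Submodule.span ℝ {fun i => ((v i : ℝ))}

/-- A subspace of `ℝⁿ` spanned by vectors of `ℚⁿ`. -/
def IsRatSubmodule {n : ℕ} (W : Submodule ℝ (Fin n → ℝ)) : Prop :=
  ∃ T : Set (Fin n → ℚ),
    W = Submodule.span ℝ ((fun (v : Fin n → ℚ) (i : Fin n) => ((v i : ℝ))) '' T)

/-- A Schottky system `(S, 𝒜, ℛ)` with respect to the metric `d`: `S` is a nonempty
set of rank-1 unipotents, `𝒜 ⊆ ℛ` are closed, and for each `u ∈ S` there are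
`δ_u ≥ ε_u > 0` satisfying the ping-pong conditions. -/
structure IsSchottky {n : ℕ} (d : Proj n → Proj n → ℝ) (S : Set (SLZ n))
    (A R : Set (Proj n)) : Prop where
  nonempty : S.Nonempty
  unip : ∀ u ∈ S, IsR1U u
  AsubR : A ⊆ R
  closedA : IsClosed A
  closedR : IsClosed R
  cond : ∃ ε δ : SLZ n → ℝ, (∀ u ∈ S, 0 < ε u ∧ ε u ≤ δ u) ∧
    (∀ u ∈ S, ∀ k : ℤ, k ≠ 0 → ∀ x, x ∉ oThick d (fixSet u) (δ u) →
      act (u ^ k) x ∈ oThick d (attSet u) (ε u)) ∧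
    (∀ u ∈ S, ∀ v ∈ S, u ≠ v → oThick d (attSet u) (ε u) ∩ oThick d (fixSet v) (δ v) = ∅) ∧
    (∀ u ∈ S, oThick d (attSet u) (ε u) ⊆ A) ∧
    (∀ u ∈ S, oThick d (fixSet u) (δ u) ⊆ R)

/-- `H` is profinitely dense in `G`: `HN = G` for every finite-index normal `N ⊴ G`. -/
def ProfinitelyDense {G : Type*} [Group G] (H : Subgroup G) : Prop :=
  ∀ N : Subgroup G, N.Normal → N.FiniteIndex → H ⊔ N = ⊤

/-- `M` is a maximal (proper) subgroup of `G`. -/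
def IsMaxSubgroup {G : Type*} [Group G] (M : Subgroup G) : Prop :=
  M ≠ ⊤ ∧ ∀ K : Subgroup G, M < K → K = ⊤

noncomputable instance (n : ℕ) : TopologicalSpace (SLR n) :=
  inferInstanceAs (TopologicalSpace {A : Matrix (Fin n) (Fin n) ℝ // A.det = 1})

noncomputable instance (n : ℕ) : MeasurableSpace (SLR n) := borel _

/-- `Γ ≤ SL(n,ℝ)` is a lattice: a discrete subgroup admitting a Borel fundamental
domain of finite Haar measure. -/
def IsLatticeIn {n : ℕ} (Γ : Subgroup (SLR n)) : Prop :=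
  DiscreteTopology Γ ∧
  ∃ μ : MeasureTheory.Measure (SLR n), μ.IsHaarMeasure ∧
    ∃ D : Set (SLR n), MeasurableSet D ∧ μ D < ⊤ ∧
      ∀ g : SLR n, ∃! γ : Γ, (γ : SLR n)⁻¹ * g ∈ D

/-- The difference `u - I` of a rank-1 unipotent is an outer product of orthogonal vectors. -/
theorem IsR1U.exists_vecMulVec {n : ℕ} {u : SLZ n} (hu : IsR1U u) :
    ∃ a b : Fin n → ℚ, a ≠ 0 ∧ b ≠ 0 ∧ b ⬝ᵥ a = 0 ∧ matQ u - 1 = vecMulVec a b := by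
  obtain ⟨hnil, hrank⟩ := hu
  obtain ⟨⟨a, ha⟩, ha0, hspan⟩ := finrank_eq_one_iff'.mp hrank
  have hcol : ∀ j, ∃ c : ℚ, c • a = (matQ u - 1).col j := fun j ↦ by
    obtain ⟨c, hc⟩ := hspan ⟨linQ u (Pi.single j 1), LinearMap.mem_range_self _ _⟩
    refine ⟨c, ?_⟩
    rw [← Matrix.mulVec_single_one]
    exact congrArg Subtype.val hc
  choose b hb using hcol
  have hN : matQ u - 1 = vecMulVec a b := by
    ext i j
    have := congrFun (hb j) i
    simp only [Pi.smul_apply, smul_eq_mul, Matrix.col_apply] at this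
    rw [vecMulVec_apply, ← this, mul_comm]
  have ha' : a ≠ 0 := fun h ↦ ha0 (Subtype.ext h)
  refine ⟨a, b, ha', ?_, ?_, hN⟩
  · rintro rfl
    obtain ⟨w, hw⟩ := ha
    exact ha' (by rw [← hw, linQ, hN, vecMulVec_zero, Matrix.mulVecLin_zero, LinearMap.zero_apply])
  · have htr := (LinearMap.isNilpotent_trace_of_isNilpotent hnil).eq_zero
    rw [linQ, ← Matrix.toLin'_apply', Matrix.trace_toLin'_eq, hN, trace_vecMulVec] at htr
    rwa [dotProduct_comm]

theorem matR_sub_one_eq_map {n : ℕ} (u : SLZ n) :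
    matR u - 1 = (matQ u - 1).map (algebraMap ℚ ℝ) := by
  ext i j
  by_cases h : i = j <;> simp [matR, matQ, h]

theorem IsR1U.exists_vecMulVec_real {n : ℕ} {u : SLZ n} (hu : IsR1U u) :
    ∃ a b : Fin n → ℝ, a ≠ 0 ∧ b ≠ 0 ∧ b ⬝ᵥ a = 0 ∧ matR u - 1 = vecMulVec a b := by
  obtain ⟨a, b, ha, hb, hab, hN⟩ := hu.exists_vecMulVec
  have hcast : ∀ v : Fin n → ℚ, v ≠ 0 → (fun i ↦ (v i : ℝ)) ≠ 0 := fun v hv h ↦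
    hv (funext fun i ↦ by simpa using congrFun h i)
  refine ⟨fun i ↦ a i, fun i ↦ b i, hcast a ha, hcast b hb, ?_, ?_⟩
  · simpa [dotProduct] using congrArg (Rat.cast : ℚ → ℝ) hab
  · rw [matR_sub_one_eq_map, hN]
    ext i j
    simp [vecMulVec_apply]

/-- A rank-1 unipotent fixes its point of attraction. -/
theorem IsR1U.attSet_subset_fixSet {n : ℕ} {u : SLZ n} (hu : IsR1U u) :
    attSet u ⊆ fixSet u := by
  obtain ⟨a, b, -, -, hab, hN⟩ := hu.exists_vecMulVec_real
  rintro x (hx : x.submodule = lineOf u)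
  change x.submodule ≤ hypOf u
  rw [hx]
  rintro _ ⟨w, rfl⟩
  rw [hypOf, LinearMap.mem_ker, Matrix.mulVecLin_apply, Matrix.mulVecLin_apply,
    Matrix.mulVec_mulVec, hN, vecMulVec_mul_vecMulVec, hab]
  simp

theorem IsR1U.attSet_nonempty {n : ℕ} {u : SLZ n} (hu : IsR1U u) : (attSet u).Nonempty := by
  obtain ⟨a, b, ha, hb, -, hN⟩ := hu.exists_vecMulVec_real
  refine ⟨Projectivization.mk ℝ a ha, ?_⟩
  change Projectivization.submodule _ = lineOf u
  rw [Projectivization.submodule_mk, lineOf, hN]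
  apply le_antisymm
  · rw [Submodule.span_singleton_le_iff_mem]
    have hbb : b ⬝ᵥ b ≠ 0 := fun h ↦ hb (dotProduct_self_eq_zero.mp h)
    refine ⟨(b ⬝ᵥ b)⁻¹ • b, ?_⟩
    rw [Matrix.mulVecLin_apply, vecMulVec_mulVec]
    ext i
    simp [dotProduct_smul, hbb]
  · rintro _ ⟨w, rfl⟩
    rw [Matrix.mulVecLin_apply, vecMulVec_mulVec, Submodule.mem_span_singleton]
    exact ⟨b ⬝ᵥ w, by ext i; simp [mul_comm]⟩

theorem one_add_pow_of_mul_self_eq_zero {R : Type*} [Ring R] {N : R} (hN : N * N = 0) (k : ℕ) :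
    (1 + N) ^ k = 1 + k • N := by
  induction k with
  | zero => simp
  | succ k ih =>
    rw [pow_succ, ih, mul_add, mul_one, add_mul, smul_mul_assoc, hN, smul_zero, add_zero, one_mul,
      succ_nsmul, add_assoc]

/-- Rank-1 unipotents have infinite order. -/
theorem IsR1U.zpow_ne_one {n : ℕ} {u : SLZ n} (hu : IsR1U u) {k : ℤ} (hk : k ≠ 0) :
    u ^ k ≠ 1 := by
  intro h
  obtain ⟨a, b, ha, hb, hab, hN⟩ := hu.exists_vecMulVec
  have hpow : u ^ k.natAbs = 1 := by
    rcases Int.natAbs_eq k with hk' | hk' <;> rw [hk'] at h <;> simpa using h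
  have hQ : matQ u ^ k.natAbs = 1 := by
    have hmap : SpecialLinearGroup.map (Int.castRingHom ℚ) u ^ k.natAbs = 1 := by
      rw [← map_pow, hpow, map_one]
    exact congrArg Subtype.val hmap
  have hsq : (matQ u - 1) * (matQ u - 1) = 0 := by
    rw [hN, vecMulVec_mul_vecMulVec, hab]
    simp
  have h1 := one_add_pow_of_mul_self_eq_zero hsq k.natAbs
  rw [add_sub_cancel, hQ, left_eq_add, hN] at h1
  obtain ⟨i, hi⟩ := Function.ne_iff.mp ha
  obtain ⟨j, hj⟩ := Function.ne_iff.mp hb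
  have := congrFun (congrFun h1 i) j
  simp [vecMulVec_apply] at this
  simp_all

theorem IsCompatMetric.nonneg {n : ℕ} {d : Proj n → Proj n → ℝ} (hd : IsCompatMetric d)
    (x y : Proj n) : 0 ≤ d x y := by
  linarith [hd.triangle x y x, hd.symm x y, hd.self x]

theorem IsCompatMetric.bddBelow_image {n : ℕ} {d : Proj n → Proj n → ℝ} (hd : IsCompatMetric d)
    (x : Proj n) (A : Set (Proj n)) : BddBelow (d x '' A) :=
  ⟨0, by rintro _ ⟨y, -, rfl⟩; exact hd.nonneg x y⟩

theorem IsCompatMetric.subset_oThick {n : ℕ} {d : Proj n → Proj n → ℝ} (hd : IsCompatMetric d)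
    (A : Set (Proj n)) {ε : ℝ} (hε : 0 < ε) : A ⊆ oThick d A ε := fun x hx ↦
  (csInf_le (hd.bddBelow_image x A) ⟨x, hx, hd.self x⟩).trans_lt hε

theorem IsCompatMetric.oThick_mono {n : ℕ} {d : Proj n → Proj n → ℝ} (hd : IsCompatMetric d)
    {A B : Set (Proj n)} (hA : A.Nonempty) (hAB : A ⊆ B) {ε δ : ℝ} (hεδ : ε ≤ δ) :
    oThick d A ε ⊆ oThick d B δ := fun x hx ↦
  ((csInf_le_csInf (hd.bddBelow_image x B) (hA.image _) (Set.image_mono hAB)).trans_lt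
    (show setDist d x A < ε from hx)).trans_le hεδ

theorem act_one {n : ℕ} (x : Proj n) : act (1 : SLZ n) x = x := by
  induction x using Projectivization.ind with
  | h v hv => simp [act, actR, Projectivization.map_mk]

theorem act_mul {n : ℕ} (g h : SLZ n) (x : Proj n) : act (g * h) x = act g (act h x) := by
  induction x using Projectivization.ind with
  | h v hv => simp [act, actR, Projectivization.map_mk]

/-- The projective action of `SL(n,ℤ)` as a bundled action. -/
noncomputable abbrev projMulAction (n : ℕ) : MulAction (SLZ n) (Proj n) where
  smul := act
  one_smul := act_one
  mul_smul := act_mul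

open Monoid in
/-- The free product of the infinite cyclic groups `⟨u⟩`, `u ∈ S`, embeds in `SL(n,ℤ)`. -/
theorem IsSchottky.lift_injective {n : ℕ} {d : Proj n → Proj n → ℝ} (hd : IsCompatMetric d)
    {S : Set (SLZ n)} {A R : Set (Proj n)} (hS : IsSchottky d S A R) (hnt : S.Nontrivial) :
    Function.Injective (CoprodI.lift fun u : S ↦ zpowersHom (SLZ n) (u : SLZ n)) := by
  obtain ⟨ε, δ, hεδ, hact, hdisj, -, -⟩ := hS.cond
  let _ : MulAction (SLZ n) (Proj n) := projMulAction n
  have : Nontrivial S := Set.nontrivial_coe_sort.mpr hnt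
  have hsub : ∀ u ∈ S, oThick d (attSet u) (ε u) ⊆ oThick d (fixSet u) (δ u) := fun u hu ↦
    hd.oThick_mono (hS.unip u hu).attSet_nonempty (hS.unip u hu).attSet_subset_fixSet (hεδ u hu).2
  refine CoprodI.lift_injective_of_ping_pong _ (.inr ?_)
    (fun u : S ↦ oThick d (attSet u.1) (ε u)) ?_ ?_ ?_
  · obtain ⟨u⟩ := hnt.nonempty.to_subtype
    refine ⟨u, ?_⟩
    rw [show Cardinal.mk (Multiplicative ℤ) = Cardinal.aleph0 from Cardinal.mk_int]
    exact Cardinal.ofNat_lt_aleph0.le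
  · exact fun u ↦ (hS.unip u u.2).attSet_nonempty.mono (hd.subset_oThick _ (hεδ u u.2).1)
  · intro u v huv
    refine (Set.disjoint_iff_inter_eq_empty.mpr
      (hdisj u u.2 v v.2 fun h ↦ huv (Subtype.ext h))).mono_right (hsub v v.2)
  · rintro u v huv h hh _ ⟨x, hx, rfl⟩
    refine hact u u.2 h.toAdd hh x fun hx' ↦ ?_
    have : x ∈ oThick d (attSet v.1) (ε v) ∩ oThick d (fixSet u.1) (δ u) := ⟨hx, hx'⟩
    rw [hdisj v v.2 u u.2 fun h ↦ huv (Subtype.ext h.symm)] at this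
    exact this

/-- Lemma 2.6 (ping-pong): if `(S, 𝒜, ℛ)` is a Schottky system then `S` freely
generates a free group: no nonempty reduced word `u₁^{k₁} ⋯ u_m^{k_m}` with
`u_i ∈ S`, consecutive letters distinct and all `k_i ≠ 0` equals the identity. -/
theorem schottky_ping_pong (n : ℕ) (hn : 3 ≤ n) (d : Proj n → Proj n → ℝ)
    (hd : IsCompatMetric d) (S : Set (SLZ n)) (A R : Set (Proj n))
    (hS : IsSchottky d S A R) :
    ∀ m : ℕ, 0 < m → ∀ (u : Fin m → SLZ n) (k : Fin m → ℤ),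
      (∀ i, u i ∈ S) →
      (∀ (i : ℕ) (h : i + 1 < m), u ⟨i, Nat.lt_of_succ_lt h⟩ ≠ u ⟨i + 1, h⟩) →
      (∀ i, k i ≠ 0) →
      (List.ofFn fun i => u i ^ k i).prod ≠ 1 := by
  intro m hm u k hu hne hk hprod
  by_cases hm1 : m = 1
  · subst hm1
    exact (hS.unip _ (hu 0)).zpow_ne_one (hk 0) (by simpa using hprod)
  have hnt : S.Nontrivial := ⟨_, hu _, _, hu _, hne 0 (by omega)⟩
  let w : Monoid.CoprodI.Word fun _ : S ↦ Multiplicative ℤ :=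
    { toList := List.ofFn fun i ↦ ⟨⟨u i, hu i⟩, Multiplicative.ofAdd (k i)⟩
      ne_one := by
        intro l hl
        obtain ⟨i, rfl⟩ := (List.mem_ofFn' _ _).mp hl
        exact hk i
      chain_ne := by
        rw [List.isChain_iff_getElem]
        intro i hi h
        simp only [List.length_ofFn] at hi
        exact hne i hi (by simpa using h) }
  have hw : w.prod = 1 := by
    apply IsSchottky.lift_injective hd hS hnt
    rw [map_one, ← hprod, Monoid.CoprodI.Word.prod, map_list_prod, List.map_map, List.map_ofFn]
    congr 2
  classical
  have hempty : w = .empty := Monoid.CoprodI.Word.equiv.symm.injective hw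
  have := congrArg (fun w ↦ w.toList.length) hempty
  exact hm.ne' (by simpa [w, Monoid.CoprodI.Word.empty] using this)
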